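/- Under Assumption 2 (F μ_F-strongly convex, G μ_G-strongly convex, ∇F and ∇G locally Lipschitz), for any initial data (x_0, y_0, u_0, v_0) there exists a unique global solution (x, y) with x ∈ C²([t_0, +∞), ℝ^n) and y ∈ C²([t_0, +∞), ℝ^m) of the dynamical system ẍ(t) + 2√μ_F ẋ(t) + ∇F(x(t)) + Aᵀ(y(t) + γẏ(t)) = 0, ÿ(t) + 2√μ_G ẏ(t) + ∇G(y(t)) − A(x(t) + γẋ(t)) = 0, satisfying (x(t_0), y(t_0), ẋ(t_0), ẏ(t_0)) = (x_0, y_0, u_0, v_0), where γ = max{1/√μ_F, 1/√μ_G}. -/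

import Mathlib

open scoped RealInnerProductSpace

/-- `(x, y)` together with derivative functions `x', y'` is a C² solution of the
accelerated primal-dual dynamical system on the set `S`. -/
def IsPDSol {n m : ℕ}
    (F' : EuclideanSpace ℝ (Fin n) → EuclideanSpace ℝ (Fin n))
    (G' : EuclideanSpace ℝ (Fin m) → EuclideanSpace ℝ (Fin m))
    (A : EuclideanSpace ℝ (Fin n) →L[ℝ] EuclideanSpace ℝ (Fin m))
    (μF μG γ : ℝ) (S : Set ℝ)
    (x x' : ℝ → EuclideanSpace ℝ (Fin n))
    (y y' : ℝ → EuclideanSpace ℝ (Fin m)) : Prop :=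
  (∀ t ∈ S, HasDerivAt x (x' t) t) ∧ (∀ t ∈ S, HasDerivAt y (y' t) t) ∧
  ∃ x'' : ℝ → EuclideanSpace ℝ (Fin n), ∃ y'' : ℝ → EuclideanSpace ℝ (Fin m),
    (∀ t ∈ S, HasDerivAt x' (x'' t) t) ∧ (∀ t ∈ S, HasDerivAt y' (y'' t) t) ∧
    ContinuousOn x'' S ∧ ContinuousOn y'' S ∧
    ∀ t ∈ S,
      x'' t + (2 * Real.sqrt μF) • x' t + F' (x t)
        + (ContinuousLinearMap.adjoint A) (y t + γ • y' t) = 0 ∧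
      y'' t + (2 * Real.sqrt μG) • y' t + G' (y t) - A (x t + γ • x' t) = 0

open Set Metric Filter Topology
open scoped NNReal

section GlobalFlow

variable {E : Type*} [NormedAddCommGroup E] [NormedSpace ℝ E]

/-- A scalar function whose derivative is at most `c` times itself grows at most exponentially. -/
lemma le_mul_exp_of_hasDerivWithinAt_le {φ φ' : ℝ → ℝ} {a b c : ℝ}
    (hφ : ∀ t ∈ Icc a b, HasDerivWithinAt φ (φ' t) (Icc a b) t)
    (hle : ∀ t ∈ Icc a b, φ' t ≤ c * φ t) {t : ℝ} (ht : t ∈ Icc a b) :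
    φ t ≤ φ a * Real.exp (c * (t - a)) := by
  have hd : ∀ s ∈ Icc a b, HasDerivWithinAt (fun s => φ s * Real.exp (-c * (s - a)))
      (φ' s * Real.exp (-c * (s - a)) + φ s * (Real.exp (-c * (s - a)) * (-c))) (Icc a b) s := by
    intro s hs
    have h : HasDerivAt (fun s : ℝ => -c * (s - a)) (-c) s := by
      simpa using ((hasDerivAt_id s).sub_const a).const_mul (-c)
    exact (hφ s hs).mul h.exp.hasDerivWithinAt
  have hanti := antitoneOn_of_hasDerivWithinAt_nonpos (convex_Icc a b)
    (fun s hs => (hd s hs).continuousWithinAt)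
    (fun s hs => (hd s (interior_subset hs)).mono interior_subset)
    (fun s hs => by
      nlinarith [hle s (interior_subset hs), Real.exp_pos (-c * (s - a))])
  have h := hanti (left_mem_Icc.2 (ht.1.trans ht.2)) ht ht.1
  have he : Real.exp (-c * (t - a)) * Real.exp (c * (t - a)) = 1 := by
    rw [← Real.exp_add]; simp
  have h2 := mul_le_mul_of_nonneg_right h (Real.exp_pos (c * (t - a))).le
  simp only [sub_self, mul_zero, Real.exp_zero, mul_one] at h2
  rwa [mul_assoc, he, mul_one] at h2

/-- Uniqueness of solutions of an autonomous ODE with locally Lipschitz vector field. -/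
lemma LocallyLipschitz.eqOn_Icc_of_hasDerivWithinAt {f : E → E} (hf : LocallyLipschitz f)
    {a b : ℝ} {z w : ℝ → E}
    (hz : ∀ t ∈ Icc a b, HasDerivWithinAt z (f (z t)) (Icc a b) t)
    (hw : ∀ t ∈ Icc a b, HasDerivWithinAt w (f (w t)) (Icc a b) t)
    (h : z a = w a) : EqOn z w (Icc a b) := by
  have hzc : ContinuousOn z (Icc a b) := fun t ht => (hz t ht).continuousWithinAt
  have hwc : ContinuousOn w (Icc a b) := fun t ht => (hw t ht).continuousWithinAt
  obtain ⟨K, hK⟩ :=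
    LocallyLipschitzOn.exists_lipschitzOnWith_of_compact
    ((isCompact_Icc.image_of_continuousOn hzc).union (isCompact_Icc.image_of_continuousOn hwc))
    hf.locallyLipschitzOn
  have hright : ∀ {z : ℝ → E}, (∀ t ∈ Icc a b, HasDerivWithinAt z (f (z t)) (Icc a b) t) →
      ∀ t ∈ Ico a b, HasDerivWithinAt z (f (z t)) (Ici t) t := fun hz t ht =>
    (hz t (Ico_subset_Icc_self ht)).mono_of_mem_nhdsWithin
      (mem_of_superset (Icc_mem_nhdsGE ht.2) (Icc_subset_Icc_left ht.1))
  exact ODE_solution_unique_of_mem_Icc_right (v := fun _ => f) (fun _ _ => hK) hzc (hright hz)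
    (fun t ht => Or.inl (mem_image_of_mem z (Ico_subset_Icc_self ht))) hwc (hright hw)
    (fun t ht => Or.inr (mem_image_of_mem w (Ico_subset_Icc_self ht))) h

variable [FiniteDimensional ℝ E]

/-- A bounded locally Lipschitz vector field has solutions on every compact time interval. -/
lemma LocallyLipschitz.exists_hasDerivWithinAt_Icc_of_bounded {f : E → E}
    (hf : LocallyLipschitz f) {L : ℝ≥0} (hL : ∀ z, ‖f z‖ ≤ L) {a b : ℝ} (hab : a ≤ b) (z₀ : E) :
    ∃ z : ℝ → E, z a = z₀ ∧ ∀ t ∈ Icc a b, HasDerivWithinAt z (f (z t)) (Icc a b) t := by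
  obtain ⟨K, hK⟩ :=
    LocallyLipschitzOn.exists_lipschitzOnWith_of_compact
    (isCompact_closedBall z₀ ((L * (b - a).toNNReal : ℝ≥0) : ℝ)) hf.locallyLipschitzOn
  have hPL : IsPicardLindelof (fun _ : ℝ => f) (⟨a, left_mem_Icc.2 hab⟩ : Icc a b) z₀
      (L * (b - a).toNNReal) 0 L K := by
    refine .of_time_independent (fun z _ => hL z) hK ?_
    simp [Real.coe_toNNReal _ (sub_nonneg.2 hab), hab]
  exact hPL.exists_eq_forall_mem_Icc_hasDerivWithinAt₀

/-- If a nonnegative coercive function `V` satisfies `V' f ≤ c V`, then the vector field `f` has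
solutions on every compact time interval. -/
lemma LocallyLipschitz.exists_hasDerivWithinAt_Icc_of_lyapunov {f : E → E}
    (hf : LocallyLipschitz f) {V : E → ℝ} {V' : E → E →L[ℝ] ℝ} {c : ℝ} (hc : 0 ≤ c)
    (hV : ∀ z, HasFDerivAt V (V' z) z) (hV0 : ∀ z, 0 ≤ V z)
    (hVb : ∀ C, Bornology.IsBounded {z | V z ≤ C}) (hVf : ∀ z, V' z (f z) ≤ c * V z)
    {a b : ℝ} (hab : a ≤ b) (z₀ : E) :
    ∃ z : ℝ → E, z a = z₀ ∧ ∀ t ∈ Icc a b, HasDerivWithinAt z (f (z t)) (Icc a b) t := by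
  obtain ⟨B, hB0, hB⟩ := (hVb (V z₀ * Real.exp (c * (b - a)))).subset_closedBall_lt 0 0
  let χ : ContDiffBump (0 : E) := ⟨B, B + 1, hB0, by linarith⟩
  have hχ : LocallyLipschitz χ := (χ.contDiff (n := 1)).locallyLipschitz
  have hg : LocallyLipschitz (fun z => χ z • f z) :=
    (contDiff_smul (𝕜 := ℝ) (F := E) (n := 1)).locallyLipschitz.comp (hχ.prodMk hf)
  have hsupp : HasCompactSupport (fun z => χ z • f z) := χ.hasCompactSupport.smul_right
  obtain ⟨L, hL⟩ := hsupp.exists_bound_of_continuous hg.continuous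
  obtain ⟨z, hz0, hz⟩ := hg.exists_hasDerivWithinAt_Icc_of_bounded
    (L := L.toNNReal) (fun z => (hL z).trans (Real.le_coe_toNNReal L)) hab z₀
  refine ⟨z, hz0, fun t ht => ?_⟩
  have hgrow := le_mul_exp_of_hasDerivWithinAt_le (φ := V ∘ z) (c := c)
    (fun s hs => (hV (z s)).comp_hasDerivWithinAt s (hz s hs)) (fun s _ => by
      have h0 := χ.nonneg (x := z s)
      have h1 := χ.le_one (x := z s)
      have h2 := mul_nonneg hc (hV0 (z s))
      simp only [map_smul, smul_eq_mul, Function.comp_apply]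
      nlinarith [mul_le_mul_of_nonneg_left (hVf (z s)) h0]) ht
  have hmem : z t ∈ closedBall (0 : E) B := by
    refine hB (hgrow.trans ?_)
    rw [Function.comp_apply, hz0]
    have := hV0 z₀
    have := ht.2
    gcongr
  have := hz t ht
  rwa [χ.one_of_mem_closedBall hmem, one_smul] at this

/-- If a nonnegative coercive function `V` satisfies `V' f ≤ c V`, then the vector field `f` has
a solution on `[a, ∞)` with any initial value, differentiable in the two-sided sense at `a`. -/
theorem LocallyLipschitz.exists_hasDerivAt_Ici_of_lyapunov {f : E → E}
    (hf : LocallyLipschitz f) {V : E → ℝ} {V' : E → E →L[ℝ] ℝ} {c : ℝ} (hc : 0 ≤ c)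
    (hV : ∀ z, HasFDerivAt V (V' z) z) (hV0 : ∀ z, 0 ≤ V z)
    (hVb : ∀ C, Bornology.IsBounded {z | V z ≤ C}) (hVf : ∀ z, V' z (f z) ≤ c * V z)
    (a : ℝ) (z₀ : E) :
    ∃ z : ℝ → E, z a = z₀ ∧ (∀ t ∈ Ici a, HasDerivAt z (f (z t)) t) ∧
      ∀ t ≤ a, z t = z₀ + (t - a) • f z₀ := by
  have hex : ∀ b : ℝ, ∃ z : ℝ → E, a ≤ b → z a = z₀ ∧
      ∀ t ∈ Icc a b, HasDerivWithinAt z (f (z t)) (Icc a b) t := fun b => by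
    by_cases hab : a ≤ b
    · obtain ⟨z, hz⟩ := hf.exists_hasDerivWithinAt_Icc_of_lyapunov hc hV hV0 hVb hVf hab z₀
      exact ⟨z, fun _ => hz⟩
    · exact ⟨fun _ => z₀, fun h => absurd h hab⟩
  choose Z hZ using hex
  have hagree : ∀ b b', a ≤ b → b ≤ b' → EqOn (Z b) (Z b') (Icc a b) := fun b b' hab hbb' =>
    hf.eqOn_Icc_of_hasDerivWithinAt (hZ b hab).2
      (fun t ht => ((hZ b' (hab.trans hbb')).2 t (Icc_subset_Icc_right hbb' ht)).mono
        (Icc_subset_Icc_right hbb'))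
      ((hZ b hab).1.trans (hZ b' (hab.trans hbb')).1.symm)
  let z : ℝ → E := fun t => if t ≤ a then z₀ + (t - a) • f z₀ else Z t t
  have hzle : ∀ t ≤ a, z t = z₀ + (t - a) • f z₀ := fun t ht => if_pos ht
  have hza : z a = z₀ := by simp [hzle a le_rfl]
  have hzZ : ∀ b t, t ∈ Icc a b → z t = Z b t := fun b t ht => by
    rcases ht.1.eq_or_lt with rfl | hlt
    · rw [hza, (hZ b ht.2).1]
    · rw [show z t = Z t t from if_neg hlt.not_ge]
      exact hagree t b ht.1 ht.2 (right_mem_Icc.2 ht.1)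
  have hright : ∀ t ∈ Ici a, HasDerivWithinAt z (f (z t)) (Ici a) t := fun t ht => by
    have hmem : t ∈ Icc a (t + 1) := ⟨ht, by linarith⟩
    have h := ((hZ (t + 1) (hmem.1.trans hmem.2)).2 t hmem).congr
      (fun s hs => hzZ (t + 1) s hs) (hzZ (t + 1) t hmem)
    rw [← hzZ (t + 1) t hmem] at h
    refine h.mono_of_mem_nhdsWithin ?_
    rw [← Ici_inter_Iic]
    exact inter_mem self_mem_nhdsWithin (mem_nhdsWithin_of_mem_nhds (Iic_mem_nhds (by linarith)))
  refine ⟨z, hza, fun t ht => ?_, hzle⟩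
  rcases (mem_Ici.1 ht).eq_or_lt with rfl | hlt
  · have hlin : HasDerivAt (fun s : ℝ => z₀ + (s - a) • f z₀) (f z₀) a := by
      simpa using (((hasDerivAt_id a).sub_const a).smul_const (f z₀)).const_add z₀
    have hleft : HasDerivWithinAt z (f (z a)) (Iic a) a := by
      rw [hza]
      exact hlin.hasDerivWithinAt.congr hzle (hzle a le_rfl)
    have h := hleft.union (hright a ht)
    rwa [Iic_union_Ici, hasDerivWithinAt_univ] at h
  · exact (hright t ht).hasDerivAt (Ici_mem_nhds hlt)

end GlobalFlow

section PrimalDual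

/-- Quadratic growth of a strongly convex differentiable function. -/
lemma quadratic_growth_of_strongConvex {X : Type*} [NormedAddCommGroup X] [InnerProductSpace ℝ X]
    {F : X → ℝ} {F' : X → X} {μ : ℝ} (hμ : 0 < μ)
    (hF : ∀ a b, F b ≥ F a + ⟪F' a, b - a⟫ + μ / 2 * ‖b - a‖ ^ 2) (x : X) :
    μ / 4 * ‖x‖ ^ 2 ≤ F x + (‖F' 0‖ ^ 2 / μ - F 0) := by
  have h := hF 0 x
  rw [sub_zero] at h
  have h1 := neg_le_of_abs_le (abs_real_inner_le_norm (F' 0) x)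
  have h2 : 0 ≤ ‖F' 0‖ ^ 2 / μ - ‖F' 0‖ * ‖x‖ + μ / 4 * ‖x‖ ^ 2 := by
    have : ‖F' 0‖ ^ 2 / μ - ‖F' 0‖ * ‖x‖ + μ / 4 * ‖x‖ ^ 2
        = (‖F' 0‖ - μ / 2 * ‖x‖) ^ 2 / μ := by
      field_simp
      ring
    rw [this]
    positivity
  linarith

lemma ContinuousLinearMap.hasFDerivAt_half_norm_sq {E X : Type*} [NormedAddCommGroup E]
    [NormedSpace ℝ E] [NormedAddCommGroup X] [InnerProductSpace ℝ X] (p : E →L[ℝ] X) (z : E) :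
    HasFDerivAt (fun z => ‖p z‖ ^ 2 / 2) ((innerSL ℝ (p z)).comp p) z := by
  have h := (p.hasFDerivAt (x := z)).norm_sq.const_mul (1 / 2)
  refine (h.congr_fderiv ?_).congr_of_eventuallyEq (.of_forall fun w => ?_)
  · ext w
    simp
  · exact div_eq_inv_mul _ _ |>.trans (by norm_num)

variable {X Y : Type*} [NormedAddCommGroup X] [InnerProductSpace ℝ X] [FiniteDimensional ℝ X]
  [NormedAddCommGroup Y] [InnerProductSpace ℝ Y] [FiniteDimensional ℝ Y]

/-- The first-order vector field of the primal-dual system, in the variables `(x, x', y, y')`. -/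
noncomputable def primalDualField (F' : X → X) (G' : Y → Y) (A : X →L[ℝ] Y) (a b γ : ℝ)
    (z : X × X × Y × Y) : X × X × Y × Y :=
  (z.2.1, -(a • z.2.1 + F' z.1 + A.adjoint (z.2.2.1 + γ • z.2.2.2)),
    z.2.2.2, -(b • z.2.2.2 + G' z.2.2.1 - A (z.1 + γ • z.2.1)))

variable {F : X → ℝ} {F' : X → X} {G : Y → ℝ} {G' : Y → Y} {μF μG : ℝ} {A : X →L[ℝ] Y} {a b γ : ℝ}

lemma locallyLipschitz_primalDualField (hF : LocallyLipschitz F') (hG : LocallyLipschitz G') :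
    LocallyLipschitz (primalDualField F' G' A a b γ) := by
  have hlin : LocallyLipschitz fun z : X × X × Y × Y =>
      (z.2.1, -(a • z.2.1 + A.adjoint (z.2.2.1 + γ • z.2.2.2)),
        z.2.2.2, -(b • z.2.2.2 - A (z.1 + γ • z.2.1))) :=
    ContDiff.locallyLipschitz (𝕂 := ℝ) (by fun_prop)
  have hF1 : LocallyLipschitz fun z : X × X × Y × Y => F' z.1 :=
    hF.comp LipschitzWith.prod_fst.locallyLipschitz
  have hG1 : LocallyLipschitz fun z : X × X × Y × Y => G' z.2.2.1 :=
    hG.comp (ContDiff.locallyLipschitz (𝕂 := ℝ) (f := fun z : X × X × Y × Y => z.2.2.1)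
      (by fun_prop))
  have h := hlin.sub ((LocallyLipschitz.const (0 : X)).prodMk
    (hF1.prodMk ((LocallyLipschitz.const (0 : Y)).prodMk hG1)))
  refine (congrArg LocallyLipschitz (funext fun z => ?_)).mp h
  simp only [primalDualField, Prod.mk_sub_mk, sub_zero, Prod.mk.injEq, true_and]
  constructor <;> abel

/-- The primal-dual vector field has a solution on `[t₀, ∞)` for each initial value. -/
lemma exists_hasDerivAt_primalDualField (hμF : 0 < μF) (hμG : 0 < μG)
    (hFdiff : ∀ z, HasGradientAt F (F' z) z) (hGdiff : ∀ z, HasGradientAt G (G' z) z)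
    (hFsc : ∀ a b, F b ≥ F a + ⟪F' a, b - a⟫ + μF / 2 * ‖b - a‖ ^ 2)
    (hGsc : ∀ a b, G b ≥ G a + ⟪G' a, b - a⟫ + μG / 2 * ‖b - a‖ ^ 2)
    (hFlip : LocallyLipschitz F') (hGlip : LocallyLipschitz G') (A : X →L[ℝ] Y)
    (ha : 0 ≤ a) (hb : 0 ≤ b) (γ t₀ : ℝ) (z₀ : X × X × Y × Y) :
    ∃ z : ℝ → X × X × Y × Y, z t₀ = z₀ ∧
      ∀ t ∈ Ici t₀, HasDerivAt z (primalDualField F' G' A a b γ (z t)) t := by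
  let CF := ‖F' 0‖ ^ 2 / μF - F 0
  let CG := ‖G' 0‖ ^ 2 / μG - G 0
  let V : X × X × Y × Y → ℝ := fun z =>
    (F z.1 + CF) + (G z.2.2.1 + CG) + (‖z.2.1‖ ^ 2 / 2 + ‖z.2.2.2‖ ^ 2 / 2)
  let S : X × X × Y × Y → ℝ := fun z => ‖z.1‖ ^ 2 + ‖z.2.1‖ ^ 2 + ‖z.2.2.1‖ ^ 2 + ‖z.2.2.2‖ ^ 2
  obtain ⟨κ, hκ, hκS⟩ : ∃ κ > 0, ∀ z, κ * S z ≤ V z := by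
    refine ⟨min (min (μF / 4) (μG / 4)) (1 / 2), by positivity, fun z => ?_⟩
    have h1 := quadratic_growth_of_strongConvex hμF hFsc z.1
    have h2 := quadratic_growth_of_strongConvex hμG hGsc z.2.2.1
    set κ := min (min (μF / 4) (μG / 4)) (1 / 2)
    have hκF : κ ≤ μF / 4 := (min_le_left _ _).trans (min_le_left _ _)
    have hκG : κ ≤ μG / 4 := (min_le_left _ _).trans (min_le_right _ _)
    have hκ2 : κ ≤ 1 / 2 := min_le_right _ _
    have e1 := mul_le_mul_of_nonneg_right hκF (sq_nonneg ‖z.1‖)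
    have e2 := mul_le_mul_of_nonneg_right hκG (sq_nonneg ‖z.2.2.1‖)
    have e3 := mul_le_mul_of_nonneg_right hκ2 (sq_nonneg ‖z.2.1‖)
    have e4 := mul_le_mul_of_nonneg_right hκ2 (sq_nonneg ‖z.2.2.2‖)
    simp only [V, S, CF, CG]
    linarith
  have hS0 : ∀ z, 0 ≤ S z := fun z => by positivity
  let p1 : X × X × Y × Y →L[ℝ] X := .fst ℝ X (X × Y × Y)
  let p2 : X × X × Y × Y →L[ℝ] X := .comp (.fst ℝ X (Y × Y)) (.snd ℝ X (X × Y × Y))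
  let p34 : X × X × Y × Y →L[ℝ] Y × Y := .comp (.snd ℝ X (Y × Y)) (.snd ℝ X (X × Y × Y))
  let p3 : X × X × Y × Y →L[ℝ] Y := .comp (.fst ℝ Y Y) p34
  let p4 : X × X × Y × Y →L[ℝ] Y := .comp (.snd ℝ Y Y) p34
  let V' : X × X × Y × Y → X × X × Y × Y →L[ℝ] ℝ := fun z =>
    (innerSL ℝ (F' z.1)).comp p1 + (innerSL ℝ (G' z.2.2.1)).comp p3 +
      ((innerSL ℝ z.2.1).comp p2 + (innerSL ℝ z.2.2.2).comp p4)
  have hV : ∀ z, HasFDerivAt V (V' z) z := fun z => by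
    have hF1 : HasFDerivAt (fun z : X × X × Y × Y => F z.1) ((innerSL ℝ (F' z.1)).comp p1) z :=
      HasFDerivAt.comp z (hFdiff z.1).hasFDerivAt p1.hasFDerivAt
    have hG1 : HasFDerivAt (fun z : X × X × Y × Y => G z.2.2.1)
        ((innerSL ℝ (G' z.2.2.1)).comp p3) z :=
      HasFDerivAt.comp z (hGdiff z.2.2.1).hasFDerivAt p3.hasFDerivAt
    have hu : HasFDerivAt (fun z : X × X × Y × Y => ‖z.2.1‖ ^ 2 / 2)
        ((innerSL ℝ z.2.1).comp p2) z := p2.hasFDerivAt_half_norm_sq z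
    have hv : HasFDerivAt (fun z : X × X × Y × Y => ‖z.2.2.2‖ ^ 2 / 2)
        ((innerSL ℝ z.2.2.2).comp p4) z := p4.hasFDerivAt_half_norm_sq z
    exact ((hF1.add_const CF).add (hG1.add_const CG)).add (hu.add hv)
  have hVb : ∀ C, Bornology.IsBounded {z | V z ≤ C} := fun C => by
    refine (isBounded_closedBall (x := (0 : X × X × Y × Y)) (r := C / κ + 1)).subset fun z hz => ?_
    have hS : S z ≤ C / κ := by
      rw [le_div_iff₀ hκ, mul_comm]
      exact (hκS z).trans hz
    simp only [S] at hS
    rw [mem_closedBall_zero_iff, Prod.norm_def, Prod.norm_def, Prod.norm_def]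
    refine max_le ?_ (max_le ?_ (max_le ?_ ?_)) <;>
      nlinarith [sq_nonneg (‖z.1‖ - 1), sq_nonneg (‖z.2.1‖ - 1), sq_nonneg (‖z.2.2.1‖ - 1),
        sq_nonneg (‖z.2.2.2‖ - 1), sq_nonneg ‖z.1‖, sq_nonneg ‖z.2.1‖, sq_nonneg ‖z.2.2.1‖,
        sq_nonneg ‖z.2.2.2‖]
  have hVf : ∀ z, V' z (primalDualField F' G' A a b γ z) ≤ ‖A‖ / (2 * κ) * V z := by
    rintro ⟨x, u, y, v⟩
    have hval : V' (x, u, y, v) (primalDualField F' G' A a b γ (x, u, y, v)) =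
        -(a * ‖u‖ ^ 2) - b * ‖v‖ ^ 2 + ⟪v, A x⟫ - ⟪A u, y⟫ := by
      simp only [V', p1, p2, p3, p4, p34, primalDualField, add_apply,
        ContinuousLinearMap.comp_apply, ContinuousLinearMap.coe_fst', ContinuousLinearMap.coe_snd',
        innerSL_apply_apply, inner_neg_right, inner_add_right, inner_sub_right, inner_smul_right,
        map_add, map_smul, ContinuousLinearMap.adjoint_inner_right, real_inner_self_eq_norm_sq]
      rw [real_inner_comm u (F' x), real_inner_comm v (G' y), real_inner_comm v (A u)]
      ring
    have h1 : ⟪v, A x⟫ ≤ ‖v‖ * (‖A‖ * ‖x‖) :=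
      (real_inner_le_norm _ _).trans (by gcongr; exact A.le_opNorm x)
    have h2 : -⟪A u, y⟫ ≤ ‖A‖ * ‖u‖ * ‖y‖ :=
      (neg_le_of_abs_le (abs_real_inner_le_norm _ _) |> neg_le.1).trans
        (by gcongr; exact A.le_opNorm u)
    have h3 : ‖A‖ / 2 * S (x, u, y, v) ≤ ‖A‖ / (2 * κ) * V (x, u, y, v) := by
      calc ‖A‖ / 2 * S (x, u, y, v) = ‖A‖ / (2 * κ) * (κ * S (x, u, y, v)) := by field_simp
        _ ≤ _ := by gcongr; exact hκS _
    refine le_trans ?_ h3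
    rw [hval]
    simp only [S]
    nlinarith [mul_nonneg ha (sq_nonneg ‖u‖), mul_nonneg hb (sq_nonneg ‖v‖),
      mul_nonneg (norm_nonneg A) (sq_nonneg (‖v‖ - ‖x‖)),
      mul_nonneg (norm_nonneg A) (sq_nonneg (‖u‖ - ‖y‖))]
  obtain ⟨z, hz0, hz, -⟩ :=
    (locallyLipschitz_primalDualField (A := A) (a := a) (b := b) (γ := γ) hFlip
      hGlip).exists_hasDerivAt_Ici_of_lyapunov (by positivity) hV
      (fun z => (mul_nonneg hκ.le (hS0 z)).trans (hκS z)) hVb hVf t₀ z₀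
  exact ⟨z, hz0, hz⟩

end PrimalDual

section Reduction

variable {n m : ℕ} {F' : EuclideanSpace ℝ (Fin n) → EuclideanSpace ℝ (Fin n)}
  {G' : EuclideanSpace ℝ (Fin m) → EuclideanSpace ℝ (Fin m)}
  {A : EuclideanSpace ℝ (Fin n) →L[ℝ] EuclideanSpace ℝ (Fin m)} {μF μG γ : ℝ} {S : Set ℝ}

lemma IsPDSol.hasDerivAt {x x' : ℝ → EuclideanSpace ℝ (Fin n)}
    {y y' : ℝ → EuclideanSpace ℝ (Fin m)} (h : IsPDSol F' G' A μF μG γ S x x' y y') :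
    ∀ t ∈ S, HasDerivAt (fun t => (x t, x' t, y t, y' t))
      (primalDualField F' G' A (2 * Real.sqrt μF) (2 * Real.sqrt μG) γ
        (x t, x' t, y t, y' t)) t := by
  obtain ⟨hx, hy, x'', y'', hx', hy', -, -, heq⟩ := h
  intro t ht
  have h := (hx t ht).prodMk ((hx' t ht).prodMk ((hy t ht).prodMk (hy' t ht)))
  obtain ⟨e1, e2⟩ := heq t ht
  convert h using 1
  simp only [primalDualField, Prod.mk.injEq, true_and]
  constructor
  · rw [neg_eq_iff_add_eq_zero, ← e1]; abel
  · rw [neg_eq_iff_add_eq_zero, ← e2]; abel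

lemma isPDSol_of_hasDerivAt (hF : Continuous F') (hG : Continuous G')
    {z : ℝ → EuclideanSpace ℝ (Fin n) × EuclideanSpace ℝ (Fin n) ×
      EuclideanSpace ℝ (Fin m) × EuclideanSpace ℝ (Fin m)}
    (hz : ∀ t ∈ S, HasDerivAt z
      (primalDualField F' G' A (2 * Real.sqrt μF) (2 * Real.sqrt μG) γ (z t)) t) :
    IsPDSol F' G' A μF μG γ S (fun t => (z t).1) (fun t => (z t).2.1)
      (fun t => (z t).2.2.1) (fun t => (z t).2.2.2) := by
  have hzc : ContinuousOn z S := fun t ht => (hz t ht).continuousAt.continuousWithinAt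
  have hfc : Continuous (primalDualField F' G' A (2 * Real.sqrt μF) (2 * Real.sqrt μG) γ) := by
    unfold primalDualField
    fun_prop
  have hc := hfc.comp_continuousOn hzc
  refine ⟨fun t ht => (hz t ht).fst, fun t ht => (hz t ht).snd.snd.fst, _, _,
    fun t ht => (hz t ht).snd.fst, fun t ht => (hz t ht).snd.snd.snd,
    hc.snd.fst, hc.snd.snd.snd, fun t _ => ⟨?_, ?_⟩⟩
  · simp only [primalDualField]; abel
  · simp only [primalDualField]; abel

end Reduction

theorem stmt_14 {n m : ℕ} (F : EuclideanSpace ℝ (Fin n) → ℝ)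
    (G : EuclideanSpace ℝ (Fin m) → ℝ)
    (F' : EuclideanSpace ℝ (Fin n) → EuclideanSpace ℝ (Fin n))
    (G' : EuclideanSpace ℝ (Fin m) → EuclideanSpace ℝ (Fin m))
    (μF μG : ℝ) (hμF : 0 < μF) (hμG : 0 < μG)
    (A : EuclideanSpace ℝ (Fin n) →L[ℝ] EuclideanSpace ℝ (Fin m))
    (hFdiff : ∀ z, HasGradientAt F (F' z) z)
    (hGdiff : ∀ z, HasGradientAt G (G' z) z)
    (hFsc : ∀ a b, F b ≥ F a + ⟪F' a, b - a⟫ + μF / 2 * ‖b - a‖ ^ 2)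
    (hGsc : ∀ a b, G b ≥ G a + ⟪G' a, b - a⟫ + μG / 2 * ‖b - a‖ ^ 2)
    (hFlip : LocallyLipschitz F') (hGlip : LocallyLipschitz G')
    (γ : ℝ) (hγ : γ = max (1 / Real.sqrt μF) (1 / Real.sqrt μG))
    (t0 : ℝ) (ht0 : 0 ≤ t0)
    (x0 u0 : EuclideanSpace ℝ (Fin n)) (y0 v0 : EuclideanSpace ℝ (Fin m)) :
    (∃ (x x' : ℝ → EuclideanSpace ℝ (Fin n))
        (y y' : ℝ → EuclideanSpace ℝ (Fin m)),
      IsPDSol F' G' A μF μG γ (Set.Ici t0) x x' y y' ∧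
      x t0 = x0 ∧ y t0 = y0 ∧ x' t0 = u0 ∧ y' t0 = v0) ∧
    (∀ (x₁ x₁' : ℝ → EuclideanSpace ℝ (Fin n))
        (y₁ y₁' : ℝ → EuclideanSpace ℝ (Fin m))
        (x₂ x₂' : ℝ → EuclideanSpace ℝ (Fin n))
        (y₂ y₂' : ℝ → EuclideanSpace ℝ (Fin m)),
      IsPDSol F' G' A μF μG γ (Set.Ici t0) x₁ x₁' y₁ y₁' →
      x₁ t0 = x0 → y₁ t0 = y0 → x₁' t0 = u0 → y₁' t0 = v0 →
      IsPDSol F' G' A μF μG γ (Set.Ici t0) x₂ x₂' y₂ y₂' →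
      x₂ t0 = x0 → y₂ t0 = y0 → x₂' t0 = u0 → y₂' t0 = v0 →
      ∀ t ∈ Set.Ici t0, x₁ t = x₂ t ∧ y₁ t = y₂ t) := by
  constructor
  · obtain ⟨z, hz0, hz⟩ := exists_hasDerivAt_primalDualField hμF hμG hFdiff hGdiff hFsc hGsc
      hFlip hGlip A (a := 2 * Real.sqrt μF) (b := 2 * Real.sqrt μG) (by positivity)
      (by positivity) γ t0 (x0, u0, y0, v0)
    exact ⟨_, _, _, _, isPDSol_of_hasDerivAt hFlip.continuous hGlip.continuous hz,
      by simp [hz0], by simp [hz0], by simp [hz0], by simp [hz0]⟩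
  · intro x₁ x₁' y₁ y₁' x₂ x₂' y₂ y₂' h₁ hx₁ hy₁ hx₁' hy₁' h₂ hx₂ hy₂ hx₂' hy₂' t ht
    have heq := (locallyLipschitz_primalDualField (A := A) (a := 2 * Real.sqrt μF)
      (b := 2 * Real.sqrt μG) (γ := γ) hFlip hGlip).eqOn_Icc_of_hasDerivWithinAt
      (a := t0) (b := t)
      (fun s hs => (h₁.hasDerivAt s hs.1).hasDerivWithinAt)
      (fun s hs => (h₂.hasDerivAt s hs.1).hasDerivWithinAt)
      (by simp [hx₁, hy₁, hx₁', hy₁', hx₂, hy₂, hx₂', hy₂']) (right_mem_Icc.2 ht)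
    simp only [Prod.mk.injEq] at heq
    exact ⟨heq.1, heq.2.2.1⟩
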